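/- For every u ∈ ℝ and every d > 0, sup { |U(cu)| : c ∈ ℝ, |c| ≤ d } ≤ d·|U(u)| + (1 + d)³·V₀(u). -/

import Mathlib

open MeasureTheory

/-- A Lévy measure on `ℝ`. -/
def IsLevyMeasure (ν : Measure ℝ) : Prop :=
  ν {0} = 0 ∧ ∫⁻ x, ENNReal.ofReal (min 1 (x ^ 2)) ∂ν < ⊤

/-- The centering function `τ(x) = x` for `|x| ≤ 1`, `τ(x) = x/|x|` for `|x| > 1`. -/
noncomputable def tau (x : ℝ) : ℝ := if |x| ≤ 1 then x else x / |x|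

/-- `U(u) = u·a + ∫ (τ(xu) − u·τ(x)) ρ(dx)`, where `ρ = ρ⁺ − ρ⁻`. -/
noncomputable def Ufun (a : ℝ) (ρp ρm : Measure ℝ) (u : ℝ) : ℝ :=
  u * a + ((∫ x, (tau (x * u) - u * tau x) ∂ρp) - (∫ x, (tau (x * u) - u * tau x) ∂ρm))

/-- `V₀(u) = ∫ min(1, |xu|²) |ρ|(dx)`, where `|ρ| = ρ⁺ + ρ⁻`. -/
noncomputable def V0fun (ρp ρm : Measure ℝ) (u : ℝ) : ℝ :=
  ∫ x, min 1 (|x * u| ^ 2) ∂(ρp + ρm)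

theorem tau_eq_max_min (x : ℝ) : tau x = max (-1) (min 1 x) := by
  unfold tau
  split_ifs with h
  · rw [abs_le] at h
    rw [min_eq_right h.2, max_eq_right h.1]
  · rcases lt_abs.1 (not_le.1 h) with h | h
    · rw [abs_of_pos (by linarith), div_self (by linarith), min_eq_left h.le]
      norm_num
    · have hx : x ≠ 0 := by linarith
      rw [abs_of_neg (by linarith), div_neg, div_self hx, min_eq_right (by linarith),
        max_eq_left (by linarith)]

theorem continuous_tau : Continuous tau := by
  rw [funext tau_eq_max_min]
  fun_prop

theorem abs_tau_le_one (x : ℝ) : |tau x| ≤ 1 := by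
  rw [tau_eq_max_min, abs_le]
  exact ⟨le_max_left _ _, max_le (by norm_num) (min_le_left _ _)⟩

theorem tau_of_abs_le_one {x : ℝ} (h : |x| ≤ 1) : tau x = x := if_pos h

theorem abs_tau_sub_self_le_sq (x : ℝ) : |tau x - x| ≤ x ^ 2 := by
  rw [tau_eq_max_min, abs_le]
  rcases le_total x 1 with h | h
  · rw [min_eq_right h]
    rcases le_total (-1) x with h' | h'
    · rw [max_eq_right h']
      constructor <;> nlinarith
    · rw [max_eq_left h']
      constructor <;> nlinarith
  · rw [min_eq_left h, max_eq_right (by norm_num)]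
    constructor <;> nlinarith

theorem abs_tau_mul_sub_mul_tau_le (c y : ℝ) :
    |tau (c * y) - c * tau y| ≤ (1 + |c|) ^ 3 * min 1 (|y| ^ 2) := by
  have hc := abs_nonneg c
  rcases le_total |y| 1 with h | h
  · rw [tau_of_abs_le_one h, min_eq_right (pow_le_one₀ (abs_nonneg y) h)]
    refine (abs_tau_sub_self_le_sq _).trans ?_
    rw [mul_pow, sq_abs, ← sq_abs c]
    gcongr
    nlinarith [pow_nonneg hc 3, pow_nonneg hc 2]
  · rw [min_eq_left (one_le_pow₀ h), mul_one]
    calc |tau (c * y) - c * tau y| ≤ |tau (c * y)| + |c * tau y| := abs_sub _ _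
      _ ≤ 1 + |c| * 1 := by
        rw [abs_mul]
        gcongr <;> exact abs_tau_le_one _
      _ ≤ (1 + |c|) ^ 3 := by nlinarith [pow_nonneg hc 3, pow_nonneg hc 2]

namespace IsLevyMeasure

variable {ν : Measure ℝ}

theorem integrable_min_one_sq (h : IsLevyMeasure ν) :
    Integrable (fun x : ℝ => min 1 (x ^ 2)) ν := by
  refine ⟨by fun_prop, ?_⟩
  rw [hasFiniteIntegral_iff_ofReal (Filter.Eventually.of_forall fun x => by positivity)]
  exact h.2

theorem integrable_min_one_abs_mul_sq (h : IsLevyMeasure ν) (u : ℝ) :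
    Integrable (fun x : ℝ => min 1 (|x * u| ^ 2)) ν := by
  refine (h.integrable_min_one_sq.const_mul (1 + u ^ 2)).mono' (by fun_prop)
    (Filter.Eventually.of_forall fun x => ?_)
  rw [Real.norm_of_nonneg (by positivity), sq_abs, mul_pow]
  rcases le_total 1 (x ^ 2) with hx | hx
  · rw [min_eq_left hx]
    exact (min_le_left _ _).trans (by nlinarith [sq_nonneg u])
  · rw [min_eq_right hx]
    exact (min_le_right _ _).trans (by nlinarith [sq_nonneg x])

theorem integrable_tau_mul_sub (h : IsLevyMeasure ν) (u : ℝ) :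
    Integrable (fun x : ℝ => tau (x * u) - u * tau x) ν := by
  have := continuous_tau
  refine (h.integrable_min_one_sq.const_mul ((1 + |u|) ^ 3)).mono'
    (by fun_prop) (Filter.Eventually.of_forall fun x => ?_)
  simpa only [Real.norm_eq_abs, mul_comm x u, sq_abs] using abs_tau_mul_sub_mul_tau_le u x

theorem abs_integral_sub_mul_integral_le (h : IsLevyMeasure ν) (c u : ℝ) :
    |(∫ x, (tau (x * (c * u)) - c * u * tau x) ∂ν) - c * ∫ x, (tau (x * u) - u * tau x) ∂ν| ≤
      (1 + |c|) ^ 3 * ∫ x, min 1 (|x * u| ^ 2) ∂ν := by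
  rw [← integral_const_mul, ← integral_const_mul, ← integral_sub (h.integrable_tau_mul_sub _)
    ((h.integrable_tau_mul_sub _).const_mul _), ← Real.norm_eq_abs]
  refine norm_integral_le_of_norm_le ((h.integrable_min_one_abs_mul_sq u).const_mul _)
    (Filter.Eventually.of_forall fun x => ?_)
  convert abs_tau_mul_sub_mul_tau_le c (x * u) using 1
  rw [Real.norm_eq_abs, mul_left_comm x c u]
  congr 1
  ring

end IsLevyMeasure

/-- For every `u ∈ ℝ` and `d > 0`,
`sup { |U(cu)| : |c| ≤ d } ≤ d·|U(u)| + (1 + d)³·V₀(u)`. -/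
theorem Ufun_sup_bound (a : ℝ) (ρp ρm : Measure ℝ)
    (hp : IsLevyMeasure ρp) (hm : IsLevyMeasure ρm) (hsing : ρp ⟂ₘ ρm)
    (u d : ℝ) (hd : 0 < d) :
    ∀ c : ℝ, |c| ≤ d →
      |Ufun a ρp ρm (c * u)| ≤ d * |Ufun a ρp ρm u| + (1 + d) ^ 3 * V0fun ρp ρm u := by
  intro c hc
  have h₁ := hp.abs_integral_sub_mul_integral_le c u
  have h₂ := hm.abs_integral_sub_mul_integral_le c u
  have hV : V0fun ρp ρm u =
      (∫ x, min 1 (|x * u| ^ 2) ∂ρp) + ∫ x, min 1 (|x * u| ^ 2) ∂ρm :=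
    integral_add_measure (hp.integrable_min_one_abs_mul_sq u) (hm.integrable_min_one_abs_mul_sq u)
  have hV₀ : 0 ≤ V0fun ρp ρm u := integral_nonneg fun x => by positivity
  have hdiff : |Ufun a ρp ρm (c * u) - c * Ufun a ρp ρm u| ≤ (1 + |c|) ^ 3 * V0fun ρp ρm u := by
    rw [hV, mul_add]
    refine le_trans (le_of_eq ?_) ((abs_sub _ _).trans (add_le_add h₁ h₂))
    congr 1
    unfold Ufun
    ring
  calc |Ufun a ρp ρm (c * u)|
      = |c * Ufun a ρp ρm u + (Ufun a ρp ρm (c * u) - c * Ufun a ρp ρm u)| := by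
        rw [add_sub_cancel]
    _ ≤ |c| * |Ufun a ρp ρm u| + (1 + |c|) ^ 3 * V0fun ρp ρm u := by
        rw [← abs_mul]
        exact (abs_add_le _ _).trans (by gcongr)
    _ ≤ d * |Ufun a ρp ρm u| + (1 + d) ^ 3 * V0fun ρp ρm u := by gcongr
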